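/- arXiv:2106.03268 — 2 statements merged into one kernel-verified Lean document; each statement's English description precedes it below -/
import Mathlib

section
/- Let m = n, let A, B ∈ ℝ^{n×n} with A − B nonsingular, and suppose Q = (Aᵀ+Bᵀ)(Aᵀ−Bᵀ)⁻¹ is nondegenerate (all principal minors of Q are nonzero). Then for every c ∈ ℝ^n, Fix(P_{C1} ∘ P_{C2}) ∩ Ω = C1 ∩ C2, where Ω = {(u,v) ∈ ℝ^n × ℝ^n : for no index i are both u_i < 0 and v_i < 0}. -/
noncomputable section

/-- The (possibly multivalued) metric projection onto a set `S`. -/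
def projSet {E : Type*} [NormedAddCommGroup E] (S : Set E) (z : E) : Set E :=
  {s ∈ S | ∀ t ∈ S, ‖s - z‖ ≤ ‖t - z‖}

/-- `C2 = {(u,v) ∈ ℝⁿ × ℝⁿ : u ≥ 0, v ≥ 0, ⟨u,v⟩ = 0}`. -/
def C2set (n : ℕ) : Set (EuclideanSpace ℝ (Fin n ⊕ Fin n)) :=
  {w | (∀ i, 0 ≤ w (Sum.inl i)) ∧ (∀ i, 0 ≤ w (Sum.inr i)) ∧
       ∑ i, w (Sum.inl i) * w (Sum.inr i) = 0}

/-- `T(u,v) = (A+B)u + (−A+B)v`. -/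
def Tmap {m n : ℕ} (A B : Matrix (Fin m) (Fin n) ℝ)
    (w : EuclideanSpace ℝ (Fin n ⊕ Fin n)) : Fin m → ℝ :=
  (A + B).mulVec (fun i => w (Sum.inl i)) + (-A + B).mulVec (fun i => w (Sum.inr i))

/-- `C1 = {w : Tw = √2 c}`. -/
def C1set {m n : ℕ} (A B : Matrix (Fin m) (Fin n) ℝ) (c : Fin m → ℝ) :
    Set (EuclideanSpace ℝ (Fin n ⊕ Fin n)) :=
  {w | Tmap A B w = Real.sqrt 2 • c}

/-- The set of fixed points of `P_{C1} ∘ P_{C2}`. -/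
def FixSet {m n : ℕ} (A B : Matrix (Fin m) (Fin n) ℝ) (c : Fin m → ℝ) :
    Set (EuclideanSpace ℝ (Fin n ⊕ Fin n)) :=
  {w | ∃ w' ∈ projSet (C2set n) w, w ∈ projSet (C1set A B c) w'}

/-- `Ω = {(u,v) : for no i are both u_i < 0 and v_i < 0}`. -/
def OmegaSet (n : ℕ) : Set (EuclideanSpace ℝ (Fin n ⊕ Fin n)) :=
  {w | ∀ i, ¬(w (Sum.inl i) < 0 ∧ w (Sum.inr i) < 0)}

/-- A matrix is nondegenerate if all of its principal minors are nonzero. -/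
def Nondegenerate {n : ℕ} (Q : Matrix (Fin n) (Fin n) ℝ) : Prop :=
  ∀ Λ : Finset (Fin n),
    (Q.submatrix (fun i : Λ => (i : Fin n)) (fun j : Λ => (j : Fin n))).det ≠ 0

/-- If a line through a point `s` of `S` closest to `z` stays inside `S`, then `s - z` is orthogonal
to the direction of that line. -/
lemma inner_eq_zero_of_mem_projSet {E : Type*} [NormedAddCommGroup E] [InnerProductSpace ℝ E]
    {S : Set E} {z s d : E} (hs : s ∈ projSet S z) (hd : ∀ t : ℝ, s + t • d ∈ S) :
    inner ℝ (s - z) d = 0 := by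
  have key : ∀ t : ℝ, 0 ≤ ‖d‖ ^ 2 * (t * t) + (2 * inner ℝ (s - z) d) * t + 0 := by
    intro t
    have h := pow_le_pow_left₀ (norm_nonneg _) (hs.2 _ (hd t)) 2
    rw [show s + t • d - z = (s - z) + t • d by abel, norm_add_sq_real, inner_smul_right,
      norm_smul, mul_pow, Real.norm_eq_abs, sq_abs] at h
    linarith
  have h := discrim_le_zero key
  rw [discrim] at h
  nlinarith [sq_nonneg (inner ℝ (s - z) d)]

lemma mul_eq_zero_of_mem_C2set {n : ℕ} {w : EuclideanSpace ℝ (Fin n ⊕ Fin n)}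
    (hw : w ∈ C2set n) (i : Fin n) : w (Sum.inl i) * w (Sum.inr i) = 0 :=
  (Finset.sum_eq_zero_iff_of_nonneg fun j _ => mul_nonneg (hw.1 j) (hw.2.1 j)).1 hw.2.2 i
    (Finset.mem_univ i)

/-- The projection onto `C2set` is optimal in every coordinate pair separately. -/
lemma coord_le_of_mem_projSet_C2set {n : ℕ} {w p : EuclideanSpace ℝ (Fin n ⊕ Fin n)}
    (hp : p ∈ projSet (C2set n) w) (i : Fin n) {a b : ℝ} (ha : 0 ≤ a) (hb : 0 ≤ b)
    (hab : a * b = 0) :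
    (p (Sum.inl i) - w (Sum.inl i)) ^ 2 + (p (Sum.inr i) - w (Sum.inr i)) ^ 2 ≤
      (a - w (Sum.inl i)) ^ 2 + (b - w (Sum.inr i)) ^ 2 := by
  set q : EuclideanSpace ℝ (Fin n ⊕ Fin n) := WithLp.toLp 2 (Sum.elim
    (Function.update (fun j => p (Sum.inl j)) i a)
    (Function.update (fun j => p (Sum.inr j)) i b))
  have hl : ∀ j, q (Sum.inl j) = Function.update (fun j => p (Sum.inl j)) i a j := fun _ => rfl
  have hr : ∀ j, q (Sum.inr j) = Function.update (fun j => p (Sum.inr j)) i b j := fun _ => rfl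
  have hqC : q ∈ C2set n := by
    refine ⟨fun j => ?_, fun j => ?_, Finset.sum_eq_zero fun j _ => ?_⟩
    · rw [hl]
      rcases eq_or_ne j i with rfl | hj
      · simpa using ha
      · simpa [hj] using hp.1.1 j
    · rw [hr]
      rcases eq_or_ne j i with rfl | hj
      · simpa using hb
      · simpa [hj] using hp.1.2.1 j
    · rw [hl, hr]
      rcases eq_or_ne j i with rfl | hj
      · simpa using hab
      · simpa [hj] using mul_eq_zero_of_mem_C2set hp.1 j
  have h := pow_le_pow_left₀ (norm_nonneg _) (hp.2 q hqC) 2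
  simp only [EuclideanSpace.norm_sq_eq, PiLp.sub_apply, Real.norm_eq_abs, sq_abs,
    Fintype.sum_sum_type, hl, hr, ← Finset.sum_add_distrib] at h
  rw [← Finset.add_sum_erase _ _ (Finset.mem_univ i),
    ← Finset.add_sum_erase _ _ (Finset.mem_univ i)] at h
  rw [Finset.sum_congr rfl (g := fun j => (p (Sum.inl j) - w (Sum.inl j)) ^ 2 +
    (p (Sum.inr j) - w (Sum.inr j)) ^ 2) (s₁ := Finset.univ.erase i) (f := fun j =>
    (Function.update (fun j => p (Sum.inl j)) i a j - w (Sum.inl j)) ^ 2 +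
    (Function.update (fun j => p (Sum.inr j)) i b j - w (Sum.inr j)) ^ 2)
    (fun j hj => by simp [Finset.ne_of_mem_erase hj])] at h
  simpa only [Function.update_self, add_le_add_iff_right] using h

/-- Projecting a point of `OmegaSet` onto `C2set` changes at most one entry of each pair. -/
lemma coord_eq_or_eq_of_mem_projSet_C2set {n : ℕ} {w p : EuclideanSpace ℝ (Fin n ⊕ Fin n)}
    (hp : p ∈ projSet (C2set n) w) (hw : w ∈ OmegaSet n) (i : Fin n) :
    p (Sum.inl i) = w (Sum.inl i) ∨ p (Sum.inr i) = w (Sum.inr i) := by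
  have hle := fun a b => @coord_le_of_mem_projSet_C2set n w p hp i a b
  have hprod := mul_eq_zero_of_mem_C2set hp.1 i
  have hx := hp.1.1 i
  have hy := hp.1.2.1 i
  have hwi := hw i
  generalize p (Sum.inl i) = x at *
  generalize p (Sum.inr i) = y at *
  generalize w (Sum.inl i) = u at *
  generalize w (Sum.inr i) = v at *
  rcases mul_eq_zero.1 hprod with rfl | rfl
  · rcases le_or_gt 0 v with hv | hv
    · have h := hle 0 v le_rfl hv (by simp)
      exact Or.inr (sub_eq_zero.1 (pow_eq_zero_iff two_ne_zero |>.1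
        (by nlinarith [sq_nonneg (y - v)])))
    · have hu : 0 ≤ u := not_lt.1 fun hu => hwi ⟨hu, hv⟩
      have h := hle u 0 hu le_rfl (by simp)
      exact Or.inl (by nlinarith [mul_nonneg hy (neg_nonneg.2 hv.le)])
  · rcases le_or_gt 0 u with hu | hu
    · have h := hle u 0 hu le_rfl (by simp)
      exact Or.inl (sub_eq_zero.1 (pow_eq_zero_iff two_ne_zero |>.1
        (by nlinarith [sq_nonneg (x - u)])))
    · have hv : 0 ≤ v := not_lt.1 fun hv => hwi ⟨hu, hv⟩
      have h := hle 0 v le_rfl hv (by simp)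
      exact Or.inr (by nlinarith [mul_nonneg hx (neg_nonneg.2 hu.le)])

/-- A nondegenerate matrix admits no nonzero `y` with `y` and `Q y` complementary. -/
lemma Nondegenerate.eq_zero_of_mul_mulVec_eq_zero {n : ℕ} {Q : Matrix (Fin n) (Fin n) ℝ}
    (hQ : Nondegenerate Q) {y : Fin n → ℝ} (h : ∀ i, y i * Q.mulVec y i = 0) : y = 0 := by
  classical
  set s : Finset (Fin n) := Finset.univ.filter fun i => y i ≠ 0 with hs
  have hy : (fun j : s => y j) = 0 := by
    refine Matrix.eq_zero_of_mulVec_eq_zero (hQ s) (funext fun i => ?_)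
    have hi : y i ≠ 0 := (Finset.mem_filter.1 i.2).2
    have h0 : ∑ j, Q i j * y j = 0 := (mul_eq_zero.1 (h i)).resolve_left hi
    change ∑ j : s, Q i j * y j = 0
    rw [Finset.sum_coe_sort s fun j => Q i j * y j, ← h0]
    refine Finset.sum_subset (Finset.subset_univ s) fun j _ hj => ?_
    have : y j = 0 := by simpa [hs] using hj
    simp [this]
  funext i
  by_contra hi
  exact hi (congrFun hy ⟨i, by simpa [hs] using hi⟩)

lemma Tmap_add_smul {m n : ℕ} (A B : Matrix (Fin m) (Fin n) ℝ)
    (w d : EuclideanSpace ℝ (Fin n ⊕ Fin n)) (t : ℝ) :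
    Tmap A B (w + t • d) = Tmap A B w + t • Tmap A B d := by
  have h : ∀ f : Fin n → Fin n ⊕ Fin n, (fun i => (w + t • d) (f i)) =
      (fun i => w (f i)) + t • fun i => d (f i) := fun f => rfl
  simp only [Tmap, h, Matrix.mulVec_add, Matrix.mulVec_smul]
  module

/-- The displacement of a projection onto `C1set` lies in the row space of `T`, written as a
graph over its second block. -/
lemma inl_sub_eq_of_mem_projSet_C1set {n : ℕ} {A B : Matrix (Fin n) (Fin n) ℝ}
    (hAB : IsUnit (A - B)) {c : Fin n → ℝ} {w p : EuclideanSpace ℝ (Fin n ⊕ Fin n)}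
    (hw : w ∈ projSet (C1set A B c) p) :
    (fun i => (w - p) (Sum.inl i)) =
      -((A.transpose + B.transpose) * (A.transpose - B.transpose)⁻¹).mulVec
        (fun i => (w - p) (Sum.inr i)) := by
  have hdet : IsUnit (A - B).det := (Matrix.isUnit_iff_isUnit_det _).1 hAB
  rw [← Matrix.transpose_add, ← Matrix.transpose_sub, ← Matrix.transpose_nonsing_inv,
    ← Matrix.transpose_mul, eq_neg_iff_add_eq_zero, ← dotProduct_eq_zero_iff]
  intro x
  set y := ((A - B)⁻¹ * (A + B)).mulVec x with hy
  set d : EuclideanSpace ℝ (Fin n ⊕ Fin n) := WithLp.toLp 2 (Sum.elim x y)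
  have hTd : Tmap A B d = 0 := by
    change (A + B).mulVec x + (-A + B).mulVec y = 0
    rw [show -A + B = -(A - B) by abel, Matrix.neg_mulVec, hy, Matrix.mulVec_mulVec,
      Matrix.mul_nonsing_inv_cancel_left _ _ hdet, add_neg_cancel]
  have horth := inner_eq_zero_of_mem_projSet (d := d) hw fun t => by
    change Tmap A B _ = _
    rw [Tmap_add_smul, hTd, smul_zero, add_zero]
    exact hw.1
  rw [real_inner_comm, PiLp.inner_apply, Fintype.sum_sum_type] at horth
  rw [add_dotProduct, Matrix.mulVec_transpose, ← Matrix.dotProduct_mulVec, ← hy]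
  exact horth

theorem fixed_points_characterization_nondegenerate {n : ℕ}
    (A B : Matrix (Fin n) (Fin n) ℝ) (hAB : IsUnit (A - B))
    (hQnd : Nondegenerate ((A.transpose + B.transpose) * (A.transpose - B.transpose)⁻¹)) :
    ∀ c : Fin n → ℝ, FixSet A B c ∩ OmegaSet n = C1set A B c ∩ C2set n := by
  intro c
  ext w
  constructor
  · rintro ⟨⟨p, hp, hw⟩, hΩ⟩
    have hu := inl_sub_eq_of_mem_projSet_C1set hAB hw
    have hv := hQnd.eq_zero_of_mul_mulVec_eq_zero (y := fun i => (w - p) (Sum.inr i)) fun i => by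
      have hi := congrFun hu i
      rw [Pi.neg_apply, eq_neg_iff_add_eq_zero, add_comm, ← eq_neg_iff_add_eq_zero] at hi
      rw [hi]
      rcases coord_eq_or_eq_of_mem_projSet_C2set hp hΩ i with h | h <;> simp [h]
    rw [hv, Matrix.mulVec_zero, neg_zero] at hu
    have hwp : w = p := by
      ext (i | i)
      · exact sub_eq_zero.1 (congrFun hu i)
      · exact sub_eq_zero.1 (congrFun hv i)
    exact ⟨hw.1, hwp ▸ hp.1⟩
  · rintro ⟨h1, h2⟩
    exact ⟨⟨w, ⟨h2, by simp⟩, h1, by simp⟩, fun i hi => (h2.1 i).not_gt hi.1⟩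
end
end

section
/- Let A ∈ ℝ^{n×n}, B = −I_n, and c ∈ ℝ^n with c_i < 0 for all i. If ‖A‖_∞ < α/2, where ‖A‖_∞ = max_i Σ_j |A_{ij}| and α = (min_i |c_i|)/(max_i |c_i|), then Fix(P_{C1} ∘ P_{C2}) = C1 ∩ C2. -/
noncomputable section

open Matrix

/-- Points of a set are their own projections onto it. -/
lemma self_mem_projSet {E : Type*} [NormedAddCommGroup E] {S : Set E} {z : E} (hz : z ∈ S) :
    z ∈ projSet S z :=
  ⟨hz, fun t _ => by simp⟩

/-- First-order optimality of a shortest vector along a line. -/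
lemma inner_eq_zero_of_norm_le_norm_add_smul {E : Type*} [NormedAddCommGroup E]
    [InnerProductSpace ℝ E] {r h : E} (H : ∀ t : ℝ, ‖r‖ ≤ ‖r + t • h‖) : inner ℝ r h = 0 := by
  have key : ∀ t : ℝ, 0 ≤ 2 * t * inner ℝ r h + t ^ 2 * ‖h‖ ^ 2 := fun t => by
    have h1 := pow_le_pow_left₀ (norm_nonneg r) (H t) 2
    rw [norm_add_sq_real, real_inner_smul_right, norm_smul, mul_pow, Real.norm_eq_abs,
      sq_abs] at h1
    linarith
  set s : ℝ := inner ℝ r h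
  have hN : 0 < ‖h‖ ^ 2 + 1 := by positivity
  have h2 := key (-s / (‖h‖ ^ 2 + 1))
  have h3 : 2 * (-s / (‖h‖ ^ 2 + 1)) * s + (-s / (‖h‖ ^ 2 + 1)) ^ 2 * ‖h‖ ^ 2
      = -(s ^ 2 * (‖h‖ ^ 2 + 2)) / (‖h‖ ^ 2 + 1) ^ 2 := by
    field_simp
    ring
  rw [h3, le_div_iff₀ (by positivity)] at h2
  have h4 : s ^ 2 = 0 := by nlinarith [sq_nonneg s, mul_nonneg (sq_nonneg s) (sq_nonneg ‖h‖)]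
  exact pow_eq_zero_iff (two_ne_zero) |>.mp h4

lemma Tmap_neg_one {n : ℕ} (A : Matrix (Fin n) (Fin n) ℝ)
    (w : EuclideanSpace ℝ (Fin n ⊕ Fin n)) :
    Tmap A (-1) w = A *ᵥ (fun i => w (Sum.inl i) - w (Sum.inr i))
      - fun i => w (Sum.inl i) + w (Sum.inr i) := by
  have h : (fun i => w (Sum.inl i) - w (Sum.inr i))
      = (fun i => w (Sum.inl i)) - fun i => w (Sum.inr i) := rfl
  rw [h, Tmap, Matrix.add_mulVec, Matrix.add_mulVec, Matrix.neg_mulVec, Matrix.neg_mulVec,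
    Matrix.neg_mulVec, Matrix.one_mulVec, Matrix.one_mulVec, Matrix.mulVec_sub]
  ext i
  simp only [Pi.add_apply, Pi.sub_apply, Pi.neg_apply]
  ring

/-- The residual of a projection onto `C1` is orthogonal to the kernel of `T`. -/
lemma residual_of_mem_projSet_C1set {n : ℕ} {A : Matrix (Fin n) (Fin n) ℝ} {c : Fin n → ℝ}
    {w w' : EuclideanSpace ℝ (Fin n ⊕ Fin n)} (hw : w ∈ projSet (C1set A (-1) c) w')
    (d : Fin n → ℝ) :
    ∑ i, ((w - w') (Sum.inl i) * ((A *ᵥ d) i + d i)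
      + (w - w') (Sum.inr i) * ((A *ᵥ d) i - d i)) = 0 := by
  let h : EuclideanSpace ℝ (Fin n ⊕ Fin n) :=
    WithLp.toLp 2 (Sum.elim (fun i => (A *ᵥ d) i + d i) (fun i => (A *ᵥ d) i - d i))
  have hmem : ∀ t : ℝ, w + t • h ∈ C1set A (-1) c := fun t => by
    have h1 : Tmap A (-1) w = Real.sqrt 2 • c := hw.1
    change Tmap A (-1) _ = _
    rw [← h1, Tmap_neg_one, Tmap_neg_one]
    have h2 : (fun i => (w + t • h) (Sum.inl i) - (w + t • h) (Sum.inr i))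
        = (fun i => w (Sum.inl i) - w (Sum.inr i)) + (2 * t) • d := by
      ext i
      simp [h]
      ring
    rw [h2, Matrix.mulVec_add, Matrix.mulVec_smul]
    ext i
    simp [h]
    ring
  have h3 : inner ℝ (w - w') h = 0 :=
    inner_eq_zero_of_norm_le_norm_add_smul fun t => by
      have := hw.2 _ (hmem t)
      rwa [add_sub_right_comm] at this
  rw [PiLp.inner_apply, Fintype.sum_sum_type, ← Finset.sum_add_distrib] at h3
  rw [← h3]
  refine Finset.sum_congr rfl fun i _ => ?_
  simp [h]
  ring

/-- A projection onto `C2` is optimal in each complementary pair of coordinates. -/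
lemma le_of_mem_projSet_C2set {n : ℕ} {w w' : EuclideanSpace ℝ (Fin n ⊕ Fin n)}
    (hw : w' ∈ projSet (C2set n) w) (i : Fin n) {a b : ℝ} (ha : 0 ≤ a) (hb : 0 ≤ b)
    (hab : a * b = 0) :
    (w' (Sum.inl i) - w (Sum.inl i)) ^ 2 + (w' (Sum.inr i) - w (Sum.inr i)) ^ 2
      ≤ (a - w (Sum.inl i)) ^ 2 + (b - w (Sum.inr i)) ^ 2 := by
  obtain ⟨⟨hu, hv, hs⟩, hopt⟩ := hw
  have hs' := (Finset.sum_eq_zero_iff_of_nonneg fun i _ => mul_nonneg (hu i) (hv i)).mp hs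
  let t : EuclideanSpace ℝ (Fin n ⊕ Fin n) := WithLp.toLp 2 (Sum.elim
    (Function.update (fun j => w' (Sum.inl j)) i a) (Function.update (fun j => w' (Sum.inr j)) i b))
  have hl : ∀ j, t (Sum.inl j) = Function.update (fun j => w' (Sum.inl j)) i a j := fun _ => rfl
  have hr : ∀ j, t (Sum.inr j) = Function.update (fun j => w' (Sum.inr j)) i b j := fun _ => rfl
  have ht : t ∈ C2set n := by
    refine ⟨fun j => ?_, fun j => ?_, Finset.sum_eq_zero fun j _ => ?_⟩ <;>
      rcases eq_or_ne j i with rfl | hj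
    all_goals simp_all
  have h1 := pow_le_pow_left₀ (norm_nonneg _) (hopt t ht) 2
  rw [EuclideanSpace.real_norm_sq_eq, EuclideanSpace.real_norm_sq_eq, Fintype.sum_sum_type,
    Fintype.sum_sum_type, ← Finset.sum_add_distrib, ← Finset.sum_add_distrib,
    ← Finset.add_sum_erase _ _ (Finset.mem_univ i),
    ← Finset.add_sum_erase _ _ (Finset.mem_univ i)] at h1
  have h2 : ∀ j ∈ Finset.univ.erase i,
      (t - w) (Sum.inl j) ^ 2 + (t - w) (Sum.inr j) ^ 2
        = (w' - w) (Sum.inl j) ^ 2 + (w' - w) (Sum.inr j) ^ 2 := fun j hj => by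
    simp [hl, hr, Finset.ne_of_mem_erase hj]
  rw [Finset.sum_congr rfl h2] at h1
  simp only [PiLp.sub_apply, hl, hr, Function.update_self] at h1
  linarith

/-- Sign conditions satisfied by the residual of a planar projection onto the complementarity
cone. -/
lemma complementarity_residual {u v u' v' : ℝ} (hu : 0 ≤ u') (hv : 0 ≤ v') (huv : u' * v' = 0)
    (H : ∀ a b : ℝ, 0 ≤ a → 0 ≤ b → a * b = 0 →
      (u' - u) ^ 2 + (v' - v) ^ 2 ≤ (a - u) ^ 2 + (b - v) ^ 2) :
    0 ≤ u * (u - u') + v * (v - v') ∧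
      (|u - u' - (v - v')| = |u - u' + (v - v')| ∨ u - u' + (v - v') ≤ 0) := by
  have aux : ∀ {x x' : ℝ}, 0 ≤ x' → (∀ a, 0 ≤ a → (x' - x) ^ 2 ≤ (a - x) ^ 2) →
      x' = max x 0 := fun {x x'} hx' hH => by
    rcases le_total x 0 with hx | hx
    · rw [max_eq_right hx]
      nlinarith [hH 0 le_rfl]
    · rw [max_eq_left hx]
      nlinarith [hH x hx]
  rcases mul_eq_zero.mp huv with h0 | h0
  · subst h0
    have h1 : v' = max v 0 := aux hv fun b hb => by linarith [H 0 b le_rfl hb (by ring)]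
    rcases le_total v 0 with h | h
    · rw [max_eq_right h] at h1
      subst h1
      have h2 := aux (x := u) le_rfl fun a ha => by linarith [H a 0 ha le_rfl (by ring)]
      have h3 : u ≤ 0 := by rw [h2]; exact le_max_left _ _
      exact ⟨by nlinarith, Or.inr (by linarith)⟩
    · rw [max_eq_left h] at h1
      subst h1
      exact ⟨by nlinarith [sq_nonneg u], Or.inl (by simp)⟩
  · subst h0
    have h1 : u' = max u 0 := aux hu fun a ha => by linarith [H a 0 ha le_rfl (by ring)]
    rcases le_total u 0 with h | h
    · rw [max_eq_right h] at h1
      subst h1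
      have h2 := aux (x := v) le_rfl fun b hb => by linarith [H 0 b le_rfl hb (by ring)]
      have h3 : v ≤ 0 := by rw [h2]; exact le_max_left _ _
      exact ⟨by nlinarith, Or.inr (by linarith)⟩
    · rw [max_eq_left h] at h1
      subst h1
      exact ⟨by nlinarith [sq_nonneg v], Or.inl (by simp)⟩

/-- The `ℓ¹` operator norm of `Aᵀ` is bounded by the largest absolute row sum of `A`. -/
lemma sum_abs_vecMul_le {m n : Type*} [Fintype m] [Fintype n] (A : Matrix m n ℝ) {ε : ℝ}
    (hε : ∀ i, ∑ j, |A i j| ≤ ε) (y : m → ℝ) :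
    ∑ j, |(y ᵥ* A) j| ≤ ε * ∑ i, |y i| := by
  calc ∑ j, |(y ᵥ* A) j| ≤ ∑ j, ∑ i, |y i| * |A i j| :=
        Finset.sum_le_sum fun j _ => by
          simp_rw [← abs_mul]
          exact Finset.abs_sum_le_sum_abs _ _
    _ = ∑ i, |y i| * ∑ j, |A i j| := by
        rw [Finset.sum_comm]
        simp_rw [Finset.mul_sum]
    _ ≤ ∑ i, |y i| * ε :=
        Finset.sum_le_sum fun i _ => mul_le_mul_of_nonneg_left (hε i) (abs_nonneg _)
    _ = ε * ∑ i, |y i| := by rw [← Finset.sum_mul, mul_comm]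

/-- Only the zero multiplier `y` satisfies the weighted sign conditions when `A` is small. -/
lemma multiplier_eq_zero {ι : Type*} [Fintype ι] (A : Matrix ι ι ℝ) {b y : ι → ℝ} {m M ε : ℝ}
    (hε : ∀ i, ∑ j, |A i j| ≤ ε) (hm : ∀ i, m ≤ b i) (hM : ∀ i, b i ≤ M) (hm0 : 0 ≤ m)
    (hM0 : 0 ≤ M) (hsmall : (m + M) * ε < m)
    (hy : ∀ i, |(y ᵥ* A) i| = |y i| ∨ 0 ≤ y i) (hsum : ∑ i, b i * y i ≤ 0) : y = 0 := by
  have h1 : ∀ i, m * |y i| - (m + M) * |(y ᵥ* A) i| ≤ b i * y i := fun i => by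
    rcases hy i with h | h
    · rw [h]
      have h2 : b i * -y i ≤ M * |y i| :=
        mul_le_mul_of_nonneg (hM i) (neg_le_abs _) (hm0.trans (hm i)) (abs_nonneg _)
      linarith
    · rw [abs_of_nonneg h]
      have := mul_le_mul_of_nonneg_right (hm i) h
      have := mul_nonneg (add_nonneg hm0 hM0) (abs_nonneg ((y ᵥ* A) i))
      linarith
  have h2 := Finset.sum_le_sum fun i (_ : i ∈ Finset.univ) => h1 i
  rw [Finset.sum_sub_distrib, ← Finset.mul_sum, ← Finset.mul_sum] at h2
  have h3 := mul_le_mul_of_nonneg_left (sum_abs_vecMul_le A hε y) (add_nonneg hm0 hM0)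
  have h4 : 0 ≤ ∑ i, |y i| := Finset.sum_nonneg fun i _ => abs_nonneg _
  have h5 : ∑ i, |y i| = 0 := by nlinarith
  ext i
  exact abs_eq_zero.mp
    ((Finset.sum_eq_zero_iff_of_nonneg fun i _ => abs_nonneg (y i)).mp h5 i (Finset.mem_univ i))

theorem fixed_points_small_norm_case {n : ℕ} (hn : 0 < n)
    (A : Matrix (Fin n) (Fin n) ℝ) (c : Fin n → ℝ) (hc : ∀ i, c i < 0)
    (hA : (⨆ i, ∑ j, |A i j|) < ((⨅ i, |c i|) / (⨆ i, |c i|)) / 2) :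
    FixSet A (-1 : Matrix (Fin n) (Fin n) ℝ) c =
      C1set A (-1 : Matrix (Fin n) (Fin n) ℝ) c ∩ C2set n := by
  have : Nonempty (Fin n) := ⟨⟨0, hn⟩⟩
  refine Set.Subset.antisymm ?_ fun w hw => ⟨w, self_mem_projSet hw.2, self_mem_projSet hw.1⟩
  rintro w ⟨w', hw', hw⟩
  set ε := ⨆ i, ∑ j, |A i j|
  set m := ⨅ i, |c i|
  set M := ⨆ i, |c i|
  have hε : ∀ i, ∑ j, |A i j| ≤ ε := le_ciSup (Set.finite_range _).bddAbove
  have hm : ∀ i, m ≤ |c i| := ciInf_le (Set.finite_range _).bddBelow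
  have hM : ∀ i, |c i| ≤ M := le_ciSup (Set.finite_range fun i => |c i|).bddAbove
  have hm0 : 0 ≤ m := le_ciInf fun i => abs_nonneg _
  have hM0 : 0 < M := (abs_pos.mpr (hc ⟨0, hn⟩).ne).trans_le (hM _)
  have hε0 : 0 ≤ ε := (Finset.sum_nonneg fun j _ => abs_nonneg _).trans (hε ⟨0, hn⟩)
  have hsmall : (m + M) * ε < m := by
    have h1 : m ≤ M := (hm ⟨0, hn⟩).trans (hM _)
    rw [div_div, lt_div_iff₀ (by positivity)] at hA
    nlinarith
  let p : Fin n → ℝ := fun i => w (Sum.inl i) - w' (Sum.inl i)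
  let q : Fin n → ℝ := fun i => w (Sum.inr i) - w' (Sum.inr i)
  let x : Fin n → ℝ := fun i => w (Sum.inl i) - w (Sum.inr i)
  let y : Fin n → ℝ := fun i => -(p i + q i)
  have hdual : ∀ d : Fin n → ℝ, y ⬝ᵥ (A *ᵥ d) = (p - q) ⬝ᵥ d := fun d => by
    have h := residual_of_mem_projSet_C1set hw d
    rw [← sub_eq_zero, ← neg_eq_zero, ← h, dotProduct, dotProduct, ← Finset.sum_sub_distrib,
      ← Finset.sum_neg_distrib]
    refine Finset.sum_congr rfl fun i _ => ?_
    simp only [y, p, q, Pi.sub_apply, PiLp.sub_apply]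
    ring
  have hAy : y ᵥ* A = p - q :=
    dotProduct_eq _ _ fun d => by rw [← Matrix.dotProduct_mulVec, hdual]
  have hT : ∀ i, (A *ᵥ x) i - (w (Sum.inl i) + w (Sum.inr i)) = Real.sqrt 2 * c i := fun i => by
    have h : Tmap A (-1) w = Real.sqrt 2 • c := hw.1
    rw [Tmap_neg_one] at h
    exact congrFun h i
  have hw'0 := (Finset.sum_eq_zero_iff_of_nonneg
    fun i _ => mul_nonneg (hw'.1.1 i) (hw'.1.2.1 i)).mp hw'.1.2.2
  have hres := fun i => complementarity_residual (hw'.1.1 i) (hw'.1.2.1 i)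
    (hw'0 i (Finset.mem_univ i)) fun a b ha hb hab => le_of_mem_projSet_C2set hw' i ha hb hab
  have hsum : ∑ i, |c i| * y i ≤ 0 := by
    have h1 : Real.sqrt 2 * ∑ i, |c i| * y i
        = -(2 * ∑ i, (w (Sum.inl i) * p i + w (Sum.inr i) * q i)) := by
      have h2 := hdual x
      rw [← sub_eq_zero, dotProduct, dotProduct, ← Finset.sum_sub_distrib] at h2
      rw [← sub_zero (-_), ← h2, Finset.mul_sum, Finset.mul_sum, ← Finset.sum_neg_distrib,
        ← Finset.sum_sub_distrib]
      refine Finset.sum_congr rfl fun i _ => ?_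
      rw [abs_of_neg (hc i), Pi.sub_apply]
      simp only [x, y] at hT ⊢
      linear_combination -(p i + q i) * hT i
    have h3 : 0 ≤ ∑ i, (w (Sum.inl i) * p i + w (Sum.inr i) * q i) :=
      Finset.sum_nonneg fun i _ => (hres i).1
    have h4 : 0 < Real.sqrt 2 := by positivity
    nlinarith
  have hy0 : y = 0 := by
    refine multiplier_eq_zero A hε hm hM hm0 hM0.le hsmall (fun i => ?_) hsum
    rw [hAy]
    refine (hres i).2.imp (fun h => ?_) fun h => ?_
    · simpa only [y, abs_neg, Pi.sub_apply] using h
    · simpa only [y, neg_nonneg] using h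
  have hww' : w = w' := by
    rw [hy0, Matrix.zero_vecMul] at hAy
    ext (i | i)
    all_goals
      have h1 : 0 = p i - q i := congrFun hAy i
      have h2 : -(p i + q i) = 0 := congrFun hy0 i
      simp only [p, q] at h1 h2
      linarith
  exact ⟨hw.1, hww' ▸ hw'.1⟩
end
end
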